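/- For complex x₁, x₂ with Re(x₁) > 1 and Re(x₂) > 1 and real α > 0: ∫_{-∞}^{∞} α^{-x₁-it} / ((x₁ + it - 1)(x₂ - it - 1)) · Γ(x₁ + it) Γ(x₂ - it) dt = (2π Γ(x₁ + x₂) / (x₁ + x₂ - 1)) · α^{-1} (α + 1)^{-x₁-x₂+2} / (x₁ + x₂ - 2), provided Re(x₁ + x₂) > 2. -/

import Mathlib

open Complex Real

open MeasureTheory in
theorem Complex.norm_Gamma_le_Gamma_re {s : ℂ} (hs : 0 < s.re) :
    ‖Complex.Gamma s‖ ≤ Real.Gamma s.re := by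
  rw [Complex.Gamma_eq_integral hs, Real.Gamma_eq_integral hs, Complex.GammaIntegral]
  refine (norm_integral_le_integral_norm _).trans_eq ?_
  refine setIntegral_congr_fun measurableSet_Ioi fun x hx => ?_
  simp [Complex.norm_cpow_eq_rpow_re_of_pos hx, Complex.norm_exp]

theorem Complex.norm_Gamma_le_div_normSq {s : ℂ} (hs : 0 < s.re) :
    ‖Complex.Gamma s‖ ≤ Real.Gamma (s.re + 2) / Complex.normSq s := by
  have h0 : s ≠ 0 := by rintro rfl; simp at hs
  have h1 : s + 1 ≠ 0 := fun h => by
    have := congrArg Complex.re h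
    simp at this
    linarith
  have key : Complex.Gamma (s + 2) = (s + 1) * (s * Complex.Gamma s) := by
    rw [← Complex.Gamma_add_one s h0, ← Complex.Gamma_add_one _ h1]
    ring_nf
  have hle := Complex.norm_Gamma_le_Gamma_re (s := s + 2) (by simp; linarith)
  rw [key, norm_mul, norm_mul] at hle
  have hn : ‖s‖ ≤ ‖s + 1‖ := by
    rw [Complex.norm_def, Complex.norm_def]
    apply Real.sqrt_le_sqrt
    simp only [Complex.normSq_apply, Complex.add_re, Complex.add_im, Complex.one_re,
      Complex.one_im]
    nlinarith
  rw [le_div_iff₀ (Complex.normSq_pos.mpr h0), Complex.normSq_eq_norm_sq]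
  calc ‖Complex.Gamma s‖ * ‖s‖ ^ 2 = ‖s‖ * (‖s‖ * ‖Complex.Gamma s‖) := by ring
    _ ≤ ‖s + 1‖ * (‖s‖ * ‖Complex.Gamma s‖) := by gcongr
    _ ≤ _ := by simpa using hle

theorem Complex.continuous_Gamma_vertical {σ : ℝ} (hσ : 0 < σ) :
    Continuous fun t : ℝ => Complex.Gamma (σ + t * Complex.I) := by
  refine continuous_iff_continuousAt.mpr fun t => ?_
  refine ContinuousAt.comp (g := Complex.Gamma) ?_ (by fun_prop)
  refine (Complex.differentiableAt_Gamma _ fun m h => ?_).continuousAt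
  have := congrArg Complex.re h
  simp at this
  have : (0 : ℝ) ≤ m := m.cast_nonneg
  linarith

theorem Complex.verticalIntegrable_Gamma {σ : ℝ} (hσ : 0 < σ) :
    Complex.VerticalIntegrable Complex.Gamma σ := by
  refine (integrable_inv_one_add_sq.const_mul (Real.Gamma (σ + 2) * (1 + 1 / σ ^ 2))).mono'
    (Complex.continuous_Gamma_vertical hσ).aestronglyMeasurable (.of_forall fun t => ?_)
  refine (Complex.norm_Gamma_le_div_normSq (by simpa using hσ)).trans ?_
  have hG : 0 < Real.Gamma (σ + 2) := Real.Gamma_pos_of_pos (by linarith)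
  have hre : ((σ : ℂ) + t * Complex.I).re = σ := by simp
  rw [hre, Complex.normSq_add_mul_I, mul_assoc, div_eq_mul_inv]
  gcongr
  rw [← div_eq_mul_inv, inv_eq_one_div, div_le_div_iff₀ (by positivity) (by positivity)]
  have : (1 + 1 / σ ^ 2) * (σ ^ 2 + t ^ 2) = 1 + t ^ 2 + σ ^ 2 + t ^ 2 / σ ^ 2 := by
    field_simp
    ring
  rw [this]
  have : 0 ≤ t ^ 2 / σ ^ 2 := by positivity
  nlinarith [sq_nonneg σ]

theorem Complex.integrable_Gamma_add_mul_I {a : ℂ} (ha : 0 < a.re) :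
    MeasureTheory.Integrable fun t : ℝ => Complex.Gamma (a + t * Complex.I) := by
  have h : MeasureTheory.Integrable fun t : ℝ => Complex.Gamma (a.re + t * Complex.I) :=
    Complex.verticalIntegrable_Gamma ha
  refine (h.comp_add_right a.im).congr (.of_forall fun t => congrArg Complex.Gamma ?_)
  push_cast
  linear_combination Complex.re_add_im a

/-- The Cahen–Mellin integral. -/
theorem Complex.integral_cpow_mul_Gamma_add_mul_I {a : ℂ} (ha : 0 < a.re) {x : ℝ} (hx : 0 < x) :
    ∫ t : ℝ, (x : ℂ) ^ (-(a + t * Complex.I)) * Complex.Gamma (a + t * Complex.I) =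
      2 * π * (Real.exp (-x) : ℂ) := by
  have hmellin {s : ℂ} (hs : 0 < s.re) :
      mellin (fun x : ℝ => (Real.exp (-x) : ℂ)) s = Complex.Gamma s := by
    rw [Complex.Gamma_eq_integral hs, Complex.GammaIntegral_eq_mellin]
  have hline (t : ℝ) : 0 < ((a.re : ℂ) + t * Complex.I).re := by simpa using ha
  have hconv : MellinConvergent (fun x : ℝ => (Real.exp (-x) : ℂ)) a.re := by
    simpa only [MellinConvergent, smul_eq_mul, mul_comm] using
      Complex.GammaIntegral_convergent (s := a.re) (by simpa using ha)
  have hvert : Complex.VerticalIntegrable (mellin fun x : ℝ => (Real.exp (-x) : ℂ)) a.re := by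
    have h := Complex.verticalIntegrable_Gamma ha
    unfold Complex.VerticalIntegrable at h ⊢
    simpa only [hmellin (hline _)] using h
  have hinv := mellinInv_mellin_eq a.re _ hx hconv hvert (by fun_prop)
  simp only [mellinInv, hmellin (hline _), smul_eq_mul] at hinv
  rw [← MeasureTheory.integral_add_right_eq_self _ a.im] at hinv
  rw [← hinv, Complex.real_smul]
  have hpi : (π : ℂ) ≠ 0 := by exact_mod_cast Real.pi_ne_zero
  have hshift (t : ℝ) : (a.re : ℂ) + ((t + a.im : ℝ) : ℂ) * Complex.I = a + t * Complex.I := by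
    push_cast
    linear_combination Complex.re_add_im a
  simp only [hshift]
  generalize ∫ t : ℝ, (x : ℂ) ^ (-(a + t * Complex.I)) * Complex.Gamma (a + t * Complex.I) = J
  push_cast
  field_simp

open MeasureTheory in
theorem Complex.integral_cpow_mul_Gamma_mul_Gamma {a b : ℂ} (ha : 0 < a.re) (hb : 0 < b.re)
    {α : ℝ} (hα : 0 < α) :
    ∫ t : ℝ, (α : ℂ) ^ (-(a + t * Complex.I)) * Complex.Gamma (a + t * Complex.I) *
        Complex.Gamma (b - t * Complex.I) =
      2 * π * Complex.Gamma (a + b) * ((α + 1 : ℝ) : ℂ) ^ (-(a + b)) := by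
  have hα' : (α : ℂ) ≠ 0 := by exact_mod_cast hα.ne'
  let F : ℝ → ℝ → ℂ := fun t u =>
    (α : ℂ) ^ (-(a + t * Complex.I)) * Complex.Gamma (a + t * Complex.I) *
      ((Real.exp (-u) : ℂ) * (u : ℂ) ^ (b - t * Complex.I - 1))
  have hF : Integrable (Function.uncurry F) (volume.prod (volume.restrict (Set.Ioi 0))) := by
    have hA := Complex.integrable_Gamma_add_mul_I ha
    have hB : Integrable (fun u : ℝ => (Real.exp (-u) : ℂ) * (u : ℂ) ^ (b - 1))
      (volume.restrict (Set.Ioi 0)) := Complex.GammaIntegral_convergent hb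
    have hprod := (hA.mul_prod hB).norm.const_mul (α ^ (-a.re))
    refine hprod.mono' ?_ ?_
    · have hmeas : Measurable fun z : ℝ × ℝ => (α : ℂ) ^ (-(a + z.1 * Complex.I)) *
          ((Real.exp (-z.2) : ℂ) * (z.2 : ℂ) ^ (b - z.1 * Complex.I - 1)) := by
        fun_prop
      refine (hmeas.aestronglyMeasurable.mul hA.aestronglyMeasurable.comp_fst).congr
        (.of_forall fun z => ?_)
      simp only [F, Function.uncurry, Pi.mul_apply]
      ring
    · have hpos : ∀ᵐ z : ℝ × ℝ ∂(volume.prod (volume.restrict (Set.Ioi 0))), 0 < z.2 :=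
        Measure.quasiMeasurePreserving_snd.ae (ae_restrict_mem measurableSet_Ioi)
      filter_upwards [hpos] with z hz
      simp only [F, Function.uncurry, norm_mul, Complex.norm_cpow_eq_rpow_re_of_pos hα,
        Complex.norm_cpow_eq_rpow_re_of_pos hz]
      apply le_of_eq
      simp
      ring
  have hinner (u : ℝ) (hu : u ∈ Set.Ioi (0 : ℝ)) :
      ∫ t : ℝ, F t u =
        2 * π * ((u : ℂ) ^ (a + b - 1) * Complex.exp (-((α + 1 : ℝ) * u))) := by
    have hu' : (u : ℂ) ≠ 0 := by exact_mod_cast (Set.mem_Ioi.mp hu).ne'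
    have hpt (t : ℝ) : F t u = ((Real.exp (-u) : ℂ) * (u : ℂ) ^ (a + b - 1)) *
        (((α * u : ℝ) : ℂ) ^ (-(a + t * Complex.I)) * Complex.Gamma (a + t * Complex.I)) := by
      have hsplit : (u : ℂ) ^ (b - t * Complex.I - 1) =
          (u : ℂ) ^ (a + b - 1) * (u : ℂ) ^ (-(a + t * Complex.I)) := by
        rw [← Complex.cpow_add _ _ hu']
        ring_nf
      rw [Complex.ofReal_mul, Complex.mul_cpow_ofReal_nonneg hα.le (Set.mem_Ioi.mp hu).le]
      simp only [F, hsplit]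
      ring
    simp only [hpt]
    rw [integral_const_mul, Complex.integral_cpow_mul_Gamma_add_mul_I ha (mul_pos hα hu)]
    have hexp : Complex.exp (-((α + 1 : ℝ) * u)) =
        (Real.exp (-u) : ℂ) * (Real.exp (-(α * u)) : ℂ) := by
      push_cast
      rw [← Complex.exp_add]
      ring_nf
    rw [hexp]
    ring
  calc _ = ∫ t : ℝ, ∫ u in Set.Ioi (0 : ℝ), F t u := by
        congr 1 with t
        rw [integral_const_mul, Complex.Gamma_eq_integral (s := b - t * Complex.I) (by simpa),
          Complex.GammaIntegral]
    _ = ∫ u in Set.Ioi (0 : ℝ), ∫ t : ℝ, F t u := integral_integral_swap hF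
    _ = ∫ u in Set.Ioi (0 : ℝ),
          2 * π * ((u : ℂ) ^ (a + b - 1) * Complex.exp (-((α + 1 : ℝ) * u))) :=
        setIntegral_congr_fun measurableSet_Ioi hinner
    _ = _ := by
        have hα1 : 0 < α + 1 := by linarith
        rw [integral_const_mul, Complex.integral_cpow_mul_exp_neg_mul_Ioi
          (by simp only [Complex.add_re]; linarith) hα1, one_div, Complex.inv_cpow _ _ ?_,
          ← Complex.cpow_neg]
        · ring
        · rw [Complex.arg_ofReal_of_nonneg hα1.le]
          exact Real.pi_pos.ne

theorem stmt7 (x₁ x₂ : ℂ) (hx₁ : 1 < x₁.re) (hx₂ : 1 < x₂.re) (hsum : 2 < (x₁ + x₂).re)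
    (α : ℝ) (hα : 0 < α) :
    ∫ t : ℝ, (α : ℂ) ^ (-x₁ - t * Complex.I) /
        ((x₁ + t * Complex.I - 1) * (x₂ - t * Complex.I - 1)) *
        Complex.Gamma (x₁ + t * Complex.I) * Complex.Gamma (x₂ - t * Complex.I)
    = (2 * Real.pi * Complex.Gamma (x₁ + x₂) / (x₁ + x₂ - 1)) *
        ((α : ℂ)⁻¹ * ((α + 1 : ℝ) : ℂ) ^ (-x₁ - x₂ + 2) / (x₁ + x₂ - 2)) := by
  have hα' : (α : ℂ) ≠ 0 := by exact_mod_cast hα.ne'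
  have hne {z : ℂ} (hz : 0 < z.re) : z ≠ 0 := by rintro rfl; simp at hz
  have hpt (t : ℝ) : (α : ℂ) ^ (-x₁ - t * Complex.I) /
        ((x₁ + t * Complex.I - 1) * (x₂ - t * Complex.I - 1)) *
        Complex.Gamma (x₁ + t * Complex.I) * Complex.Gamma (x₂ - t * Complex.I) =
      (α : ℂ)⁻¹ * ((α : ℂ) ^ (-(x₁ - 1 + t * Complex.I)) *
        Complex.Gamma (x₁ - 1 + t * Complex.I) * Complex.Gamma (x₂ - 1 - t * Complex.I)) := by
    have h₁ : x₁ - 1 + t * Complex.I ≠ 0 := hne (by simpa using hx₁)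
    have h₂ : x₂ - 1 - t * Complex.I ≠ 0 := hne (by simpa using hx₂)
    have hG₁ := Complex.Gamma_add_one _ h₁
    have hG₂ := Complex.Gamma_add_one _ h₂
    rw [show -x₁ - t * Complex.I = -1 + -(x₁ - 1 + t * Complex.I) by ring,
      Complex.cpow_add _ _ hα', Complex.cpow_neg_one,
      show x₁ + t * Complex.I - 1 = x₁ - 1 + t * Complex.I by ring,
      show x₂ - t * Complex.I - 1 = x₂ - 1 - t * Complex.I by ring,
      show x₁ + t * Complex.I = x₁ - 1 + t * Complex.I + 1 by ring,
      show x₂ - t * Complex.I = x₂ - 1 - t * Complex.I + 1 by ring, hG₁, hG₂]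
    field_simp
  have h₁ : x₁ + x₂ - 1 ≠ 0 := hne (by simp at hsum ⊢; linarith)
  have h₂ : x₁ + x₂ - 2 ≠ 0 := hne (by simpa using hsum)
  have hG : Complex.Gamma (x₁ + x₂) =
      (x₁ + x₂ - 1) * ((x₁ + x₂ - 2) * Complex.Gamma (x₁ + x₂ - 2)) := by
    rw [← Complex.Gamma_add_one _ h₂, show x₁ + x₂ - 2 + 1 = x₁ + x₂ - 1 by ring,
      ← Complex.Gamma_add_one _ h₁, sub_add_cancel]
  simp only [hpt]
  rw [MeasureTheory.integral_const_mul, Complex.integral_cpow_mul_Gamma_mul_Gamma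
    (by simpa using hx₁) (by simpa using hx₂) hα, hG,
    show x₁ - 1 + (x₂ - 1) = x₁ + x₂ - 2 by ring,
    show -x₁ - x₂ + 2 = -(x₁ + x₂ - 2) by ring]
  field_simp
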